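/- Let (p,q) lie in the triangle Δ, i.e. 0 < q < min(p, 1−p). Then the derivative g_{p,q}′(t) is negative for all t > t*_{p,q} if and only if log(((1−p)(1−q))/(p·q)) ≤ 2(1 − p − q)/(p(1−p) + q(1−q)). -/

import Mathlib

/-- `G_{p,q}(t) = exp(−t(p+q))·(1 + p(eᵗ−1))·(1 + q(eᵗ−1))`. -/
noncomputable def GPB (p q t : ℝ) : ℝ :=
  Real.exp (-(t * (p + q))) * (1 + p * (Real.exp t - 1)) * (1 + q * (Real.exp t - 1))

/-- `g_{p,q}(t) = log(G_{p,q}(t))/t²` for `t ≠ 0`, extended continuously by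
`g_{p,q}(0) = (p(1−p) + q(1−q))/2`. -/
noncomputable def gPB (p q t : ℝ) : ℝ :=
  if t = 0 then (p * (1 - p) + q * (1 - q)) / 2 else Real.log (GPB p q t) / t^2

/-- `t*_{p,q} = log(((1−p)(1−q))/(p·q))`. -/
noncomputable def tStar (p q : ℝ) : ℝ := Real.log ((1 - p) * (1 - q) / (p * q))

noncomputable def auxL (p q t : ℝ) : ℝ :=
  -(t * (p + q)) + Real.log (1 + p * (Real.exp t - 1)) + Real.log (1 + q * (Real.exp t - 1))

noncomputable def auxD (p q t : ℝ) : ℝ :=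
  -(p + q) + p * Real.exp t / (1 + p * (Real.exp t - 1))
    + q * Real.exp t / (1 + q * (Real.exp t - 1))

noncomputable def auxV (p q t : ℝ) : ℝ :=
  p * (1 - p) * Real.exp t / (1 + p * (Real.exp t - 1)) ^ 2
    + q * (1 - q) * Real.exp t / (1 + q * (Real.exp t - 1)) ^ 2

lemma aux_pos {p : ℝ} (h0 : 0 < p) (h1 : p < 1) (t : ℝ) : 0 < 1 + p * (Real.exp t - 1) := by
  nlinarith [mul_pos h0 (Real.exp_pos t)]

lemma aux_lin (p t : ℝ) :
    HasDerivAt (fun t => 1 + p * (Real.exp t - 1)) (p * Real.exp t) t :=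
  (((Real.hasDerivAt_exp t).sub_const 1).const_mul p).const_add 1

lemma aux_frac {p : ℝ} (h0 : 0 < p) (h1 : p < 1) (t : ℝ) :
    HasDerivAt (fun t => p * Real.exp t / (1 + p * (Real.exp t - 1)))
      (p * (1 - p) * Real.exp t / (1 + p * (Real.exp t - 1)) ^ 2) t := by
  have h := ((Real.hasDerivAt_exp t).const_mul p).div (aux_lin p t) (aux_pos h0 h1 t).ne'
  refine h.congr_deriv ?_
  congr 1
  ring

lemma auxL_deriv {p q : ℝ} (h0 : 0 < p) (h1 : p < 1) (k0 : 0 < q) (k1 : q < 1) (t : ℝ) :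
    HasDerivAt (auxL p q) (auxD p q t) t := by
  have a := ((hasDerivAt_id t).mul_const (p + q)).neg
  have b := (aux_lin p t).log (aux_pos h0 h1 t).ne'
  have c := (aux_lin q t).log (aux_pos k0 k1 t).ne'
  have h := (a.add b).add c
  rw [one_mul] at h
  exact h

lemma auxD_deriv {p q : ℝ} (h0 : 0 < p) (h1 : p < 1) (k0 : 0 < q) (k1 : q < 1) (t : ℝ) :
    HasDerivAt (auxD p q) (auxV p q t) t := by
  have h := ((aux_frac h0 h1 t).const_add (-(p + q))).add (aux_frac k0 k1 t)
  exact h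

lemma auxN_deriv {p q : ℝ} (h0 : 0 < p) (h1 : p < 1) (k0 : 0 < q) (k1 : q < 1) (t : ℝ) :
    HasDerivAt (fun t => t * auxD p q t - 2 * auxL p q t) (t * auxV p q t - auxD p q t) t := by
  have h := ((hasDerivAt_id t).mul (auxD_deriv h0 h1 k0 k1 t)).sub
    ((auxL_deriv h0 h1 k0 k1 t).const_mul 2)
  refine h.congr_deriv ?_
  simp only [id]
  ring

lemma aux_log {p q : ℝ} (h0 : 0 < p) (h1 : p < 1) (k0 : 0 < q) (k1 : q < 1) (t : ℝ) :
    Real.log (GPB p q t) = auxL p q t := by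
  have a := (aux_pos h0 h1 t).ne'
  have b := (aux_pos k0 k1 t).ne'
  have e := (Real.exp_pos (-(t * (p + q)))).ne'
  rw [GPB, Real.log_mul (mul_ne_zero e a) b, Real.log_mul e a, Real.log_exp, auxL]

lemma aux_g {p q : ℝ} (h0 : 0 < p) (h1 : p < 1) (k0 : 0 < q) (k1 : q < 1) {t : ℝ} (ht : 0 < t) :
    deriv (gPB p q) t = (t * auxD p q t - 2 * auxL p q t) / t ^ 3 := by
  have e : gPB p q =ᶠ[nhds t] fun t => auxL p q t / t ^ 2 := by
    filter_upwards [lt_mem_nhds ht] with s hs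
    rw [gPB, if_neg (ne_of_gt hs), aux_log h0 h1 k0 k1]
  rw [e.deriv_eq]
  have h := (auxL_deriv h0 h1 k0 k1 t).div (hasDerivAt_pow 2 t) (pow_ne_zero 2 ht.ne')
  have h2 := h.deriv
  change deriv (fun t => auxL p q t / t ^ 2) t = _ at h2
  rw [h2]
  field_simp
  push_cast
  ring

/-- the variance profile as a function of `w = x + T/x`. -/
noncomputable def auxK (S T w : ℝ) : ℝ := (S * w + 4 * T) / (w + S) ^ 2

lemma auxV_eq {p q : ℝ} (h0 : 0 < p) (h1 : p < 1) (k0 : 0 < q) (k1 : q < 1) (t : ℝ) :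
    auxV p q t = auxK ((1 - p) / p + (1 - q) / q) ((1 - p) / p * ((1 - q) / q))
      (Real.exp t + ((1 - p) / p * ((1 - q) / q)) / Real.exp t) := by
  have hx := Real.exp_pos t
  have one : ∀ r : ℝ, 0 < r → r < 1 → r * (1 - r) * Real.exp t / (1 + r * (Real.exp t - 1)) ^ 2
      = ((1 - r) / r) * Real.exp t / ((1 - r) / r + Real.exp t) ^ 2 := by
    intro r r0 r1
    have e1 : (1 - r) / r + Real.exp t = (1 + r * (Real.exp t - 1)) / r := by
      field_simp
      ring
    have := aux_pos r0 r1 t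
    rw [e1]
    field_simp
  rw [auxV, one p h0 h1, one q k0 k1]
  have hA : 0 < (1 - p) / p := div_pos (by linarith) h0
  have hB : 0 < (1 - q) / q := div_pos (by linarith) k0
  generalize (1 - p) / p = A at *
  generalize (1 - q) / q = B at *
  generalize Real.exp t = x at *
  have e : x + A * B / x + (A + B) = (A + x) * (B + x) / x := by
    field_simp
    ring
  rw [auxK, e]
  field_simp
  ring

lemma auxK_lt {S T a b : ℝ} (hS : 0 < S) (ha : 0 < a) (hab : a < b)
    (h : 0 < 4 * T * (a + b + 2 * S) + S * (a * b - S ^ 2)) : auxK S T b < auxK S T a := by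
  rw [auxK, auxK, div_lt_div_iff₀ (pow_pos (by linarith) 2) (pow_pos (by linarith) 2)]
  nlinarith [mul_pos (sub_pos.2 hab) h]

lemma auxK_gt {S T a b : ℝ} (hS : 0 < S) (ha : 0 < a) (hab : a < b)
    (h : 4 * T * (a + b + 2 * S) + S * (a * b - S ^ 2) < 0) : auxK S T a < auxK S T b := by
  rw [auxK, auxK, div_lt_div_iff₀ (pow_pos (by linarith) 2) (pow_pos (by linarith) 2)]
  nlinarith [mul_pos (sub_pos.2 hab) (neg_pos.2 h)]

set_option maxHeartbeats 1000000 in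
/-- For `(p,q)` in the triangle `Δ` (`0 < q < min(p, 1−p)`), the derivative
`g_{p,q}′(t)` is negative for all `t > t*_{p,q}` if and only if
`log(((1−p)(1−q))/(p·q)) ≤ 2(1 − p − q)/(p(1−p) + q(1−q))`. -/
theorem gPB_deriv_neg_beyond_tStar_iff (p q : ℝ) (hq0 : 0 < q) (hq : q < min p (1 - p)) :
    (∀ t > tStar p q, deriv (gPB p q) t < 0) ↔
      Real.log ((1 - p) * (1 - q) / (p * q)) ≤
        2 * (1 - p - q) / (p * (1 - p) + q * (1 - q)) := by
  obtain ⟨hqp, hqp1⟩ := lt_min_iff.1 hq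
  have h0 : 0 < p := hq0.trans hqp
  have h1 : p < 1 := by linarith
  have k1 : q < 1 := by linarith
  have hp' : 0 < 1 - p := by linarith
  have hq' : 0 < 1 - q := by linarith
  have hv : 0 < p * (1 - p) + q * (1 - q) := by positivity
  have hT1 : 1 < (1 - p) * (1 - q) / (p * q) := by
    rw [one_lt_div (by positivity)]
    nlinarith
  change _ ↔ tStar p q ≤ _
  have hτ : 0 < tStar p q := Real.log_pos hT1
  have hexp : Real.exp (tStar p q) = (1 - p) * (1 - q) / (p * q) :=
    Real.exp_log (by linarith)
  have hTe : (1 - p) / p * ((1 - q) / q) = Real.exp (tStar p q) := by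
    rw [hexp]; field_simp
  have f1 : 1 + p * (Real.exp (tStar p q) - 1) = (1 - p) / q := by
    rw [hexp]; field_simp; ring
  have f2 : 1 + q * (Real.exp (tStar p q) - 1) = (1 - q) / p := by
    rw [hexp]; field_simp; ring
  have hD : auxD p q (tStar p q) = 2 * (1 - p - q) := by
    rw [auxD, f1, f2, hexp]; field_simp; ring
  have hV : auxV p q (tStar p q) = p * (1 - p) + q * (1 - q) := by
    rw [auxV, f1, f2, hexp]; field_simp; ring
  have hL : auxL p q (tStar p q) = tStar p q * (1 - p - q) := by
    have : Real.log ((1 - p) / q) + Real.log ((1 - q) / p) = tStar p q := by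
      rw [tStar, ← Real.log_mul (by positivity) (by positivity)]
      congr 1
      field_simp
    rw [auxL, f1, f2, add_assoc, this]; ring
  have hD0 : auxD p q 0 = 0 := by
    simp [auxD]
  have hN0 : tStar p q * auxD p q (tStar p q) - 2 * auxL p q (tStar p q) = 0 := by
    rw [hD, hL]; ring
  have hder := auxN_deriv h0 h1 hq0 k1
  rw [le_div_iff₀ hv, ← hV, ← hD, ← sub_nonpos]
  have hsign : ∀ t > tStar p q, (deriv (gPB p q) t < 0 ↔ t * auxD p q t - 2 * auxL p q t < 0) := by
    intro t ht
    have ht0 := hτ.trans ht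
    rw [aux_g h0 h1 hq0 k1 ht0, div_neg_iff]
    have : 0 < t ^ 3 := by positivity
    constructor
    · rintro (h | h)
      · linarith [h.2]
      · exact h.1
    · intro h
      exact Or.inr ⟨h, this⟩
  have hVe := auxV_eq h0 h1 hq0 k1
  rw [hTe] at hVe
  have hS : 0 < (1 - p) / p + (1 - q) / q := by positivity
  generalize tStar p q = τ at *
  generalize (1 - p) / p + (1 - q) / q = S at *
  constructor
  · intro h
    have hni : τ ∉ Set.Ioi τ := by simp
    have hs := hasDerivWithinAt_iff_tendsto_slope' hni |>.1
      ((hder τ).hasDerivWithinAt (s := Set.Ioi τ))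
    refine le_of_tendsto hs ?_
    filter_upwards [self_mem_nhdsWithin] with t ht
    have := (hsign t ht).1 (h t ht)
    rw [slope_def_field, hN0]
    exact (div_neg_of_neg_of_pos (by linarith) (sub_pos.2 ht)).le
  · intro h
    have hT : 1 < Real.exp τ := Real.one_lt_exp_iff.2 hτ
    have wτ : Real.exp τ + Real.exp τ / Real.exp τ = Real.exp τ + 1 := by
      rw [div_self (Real.exp_pos τ).ne']
    -- `w` increasing beyond `τ`
    have hw : ∀ s t, τ ≤ s → s < t →
        Real.exp s + Real.exp τ / Real.exp s < Real.exp t + Real.exp τ / Real.exp t := by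
      intro s t hs hst
      have a := Real.exp_le_exp.2 hs
      have b := Real.exp_lt_exp.2 hst
      have c := Real.exp_pos s
      have d := Real.exp_pos t
      have key : Real.exp t + Real.exp τ / Real.exp t - (Real.exp s + Real.exp τ / Real.exp s)
          = (Real.exp t - Real.exp s) * (Real.exp t * Real.exp s - Real.exp τ)
            / (Real.exp t * Real.exp s) := by
        field_simp
        ring
      have : 0 < Real.exp t * Real.exp s - Real.exp τ := by nlinarith
      have := div_pos (mul_pos (sub_pos.2 b) this) (mul_pos d c)
      linarith
    have hw2 : ∀ s, 0 < s → s < τ →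
        Real.exp s + Real.exp τ / Real.exp s < Real.exp τ + 1 := by
      intro s hs hst
      have a := Real.one_lt_exp_iff.2 hs
      have b := Real.exp_lt_exp.2 hst
      have c := Real.exp_pos s
      have key : Real.exp τ + 1 - (Real.exp s + Real.exp τ / Real.exp s)
          = (Real.exp τ - Real.exp s) * (Real.exp s - 1) / Real.exp s := by
        field_simp
        ring
      have := div_pos (mul_pos (sub_pos.2 b) (sub_pos.2 a)) c
      linarith
    have hDd := auxD_deriv h0 h1 hq0 k1
    have hcont : Continuous (auxD p q) :=
      continuous_iff_continuousAt.2 fun t => (hDd t).continuousAt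
    have hmono : ∀ s t, τ ≤ s → s < t → auxV p q t < auxV p q s := by
      rcases le_or_gt 0 (8 * Real.exp τ + S * (Real.exp τ + 1 - S)) with hc | hc
      · intro s t hs hst
        rw [hVe s, hVe t]
        have hab := hw s t hs hst
        have ha : Real.exp τ + 1 ≤ Real.exp s + Real.exp τ / Real.exp s := by
          rcases hs.eq_or_lt with rfl | hs
          · exact wτ.ge
          · exact wτ ▸ (hw τ s le_rfl hs).le
        generalize Real.exp s + Real.exp τ / Real.exp s = a at *
        generalize Real.exp t + Real.exp τ / Real.exp t = b at *
        generalize Real.exp τ = T at *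
        have ha0 : 0 < a := by linarith
        apply auxK_lt hS ha0 hab
        have e1 : 0 ≤ (T + 1 + S) * (8 * T + S * (T + 1 - S)) :=
          mul_nonneg (by linarith) hc
        have e2 : (T + 1) ^ 2 ≤ a * b := by nlinarith
        have e3 : S * (T + 1) ^ 2 ≤ S * (a * b) := mul_le_mul_of_nonneg_left e2 hS.le
        have e4 : T * (2 * (T + 1)) < T * (a + b) :=
          mul_lt_mul_of_pos_left (by linarith) (by linarith)
        nlinarith
      · exfalso
        obtain ⟨ξ, ⟨hξ0, hξ1⟩, hξ⟩ := exists_hasDerivAt_eq_slope (auxD p q) (auxV p q) hτ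
          hcont.continuousOn (fun x _ => hDd x)
        have hlt : auxV p q ξ < auxV p q τ := by
          rw [hVe ξ, hVe τ, wτ]
          have hab := hw2 ξ hξ0 hξ1
          have ha0 : 0 < Real.exp ξ + Real.exp τ / Real.exp ξ := by positivity
          generalize Real.exp ξ + Real.exp τ / Real.exp ξ = a at *
          generalize Real.exp τ = T at *
          apply auxK_gt hS ha0 hab
          have e1 : (T + 1 + S) * (8 * T + S * (T + 1 - S)) < 0 :=
            mul_neg_of_pos_of_neg (by linarith) hc
          have e2 : S * (a * (T + 1)) ≤ S * ((T + 1) * (T + 1)) :=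
            mul_le_mul_of_nonneg_left (mul_le_mul_of_nonneg_right hab.le (by linarith)) hS.le
          have e4 : T * a < T * (T + 1) := mul_lt_mul_of_pos_left hab (by linarith)
          nlinarith
        rw [hξ, hD0, sub_zero, sub_zero, div_lt_iff₀ hτ] at hlt
        linarith
    intro t ht
    rw [hsign t ht]
    have hN' : ∀ s > τ, s * auxV p q s - auxD p q s < 0 := by
      intro s hs
      obtain ⟨ξ, ⟨hξ0, hξ1⟩, hξ⟩ := exists_hasDerivAt_eq_slope (auxD p q) (auxV p q) hs
        hcont.continuousOn (fun x _ => hDd x)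
      have a := hmono ξ s hξ0.le hξ1
      have b := hmono τ s le_rfl hs
      rw [hξ, lt_div_iff₀ (sub_pos.2 hs)] at a
      have c := mul_lt_mul_of_pos_left b hτ
      linarith
    obtain ⟨ξ, ⟨hξ0, hξ1⟩, hξ⟩ := exists_hasDerivAt_eq_slope _ _ ht
      (continuous_iff_continuousAt.2 fun t => (hder t).continuousAt).continuousOn
      (fun x _ => hder x)
    have a := hN' ξ hξ0
    rw [hξ, hN0, sub_zero, div_neg_iff] at a
    rcases a with a | a
    · linarith [a.2]
    · exact a.1
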